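/- Let W be a real Banach space, h, g : W → ℝ, λ ∈ ℝ, and u ∈ W \ {0}. Assume the fiber maps ĥ(t) = h(t·u) and ĝ(t) = g(t·u) are twice differentiable in a neighborhood of t = 1 and that ĝ'(1) ≠ 0. Suppose u lies on the Nehari manifold, i.e. ĥ'(1) − λ·ĝ'(1) = 0 (equivalently 𝓡ⁿ(u) := ĥ'(1)/ĝ'(1) = λ). Then the derivative at t = 1 of the fibered Rayleigh quotient r(t) = ĥ'(t)/ĝ'(t) satisfies r'(1) = (ĥ''(1) − λ·ĝ''(1))/ĝ'(1). In particular, r'(1) ≠ 0 if and only if f_λ''(u) := ĥ''(1) − λ·ĝ''(1) ≠ 0; hence if λ is a fibering regular value of 𝓡ⁿ (i.e. r'(1) ≠ 0 for every u on the Nehari manifold), then λ is an applicable value of the Nehari manifold method (f_λ''(u) ≠ 0 for every u ∈ N_λ). -/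

import Mathlib

/-- Corollary 2.4: along a fiber through a Nehari-manifold point `u`, the derivative at
`t = 1` of the fibered Rayleigh quotient `r(t) = ĥ'(t)/ĝ'(t)` equals
`(ĥ''(1) − λ·ĝ''(1))/ĝ'(1)`; in particular `r'(1) ≠ 0 ↔ f_λ''(u) ≠ 0`. -/
theorem stmt_3 {W : Type*} [NormedAddCommGroup W] [NormedSpace ℝ W] [CompleteSpace W]
    (h g : W → ℝ) (lam : ℝ) (u : W) (hu : u ≠ 0)
    (hhd : ∀ᶠ t in nhds (1 : ℝ), DifferentiableAt ℝ (fun s : ℝ => h (s • u)) t)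
    (hgd : ∀ᶠ t in nhds (1 : ℝ), DifferentiableAt ℝ (fun s : ℝ => g (s • u)) t)
    (hhd2 : DifferentiableAt ℝ (deriv (fun s : ℝ => h (s • u))) 1)
    (hgd2 : DifferentiableAt ℝ (deriv (fun s : ℝ => g (s • u))) 1)
    (hg1 : deriv (fun s : ℝ => g (s • u)) 1 ≠ 0)
    (hNehari : deriv (fun s : ℝ => h (s • u)) 1 - lam * deriv (fun s : ℝ => g (s • u)) 1 = 0) :
    deriv (fun t : ℝ => deriv (fun s : ℝ => h (s • u)) t / deriv (fun s : ℝ => g (s • u)) t) 1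
      = (deriv (deriv (fun s : ℝ => h (s • u))) 1
          - lam * deriv (deriv (fun s : ℝ => g (s • u))) 1)
        / deriv (fun s : ℝ => g (s • u)) 1 ∧
    (deriv (fun t : ℝ => deriv (fun s : ℝ => h (s • u)) t / deriv (fun s : ℝ => g (s • u)) t) 1
        ≠ 0 ↔
      deriv (deriv (fun s : ℝ => h (s • u))) 1
          - lam * deriv (deriv (fun s : ℝ => g (s • u))) 1 ≠ 0) := by
  have key : deriv (fun t : ℝ => deriv (fun s : ℝ => h (s • u)) t /
        deriv (fun s : ℝ => g (s • u)) t) 1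
      = (deriv (deriv (fun s : ℝ => h (s • u))) 1
          - lam * deriv (deriv (fun s : ℝ => g (s • u))) 1)
        / deriv (fun s : ℝ => g (s • u)) 1 := by
    rw [(hhd2.hasDerivAt.fun_div hgd2.hasDerivAt hg1).deriv, sub_eq_zero.mp hNehari]
    field_simp
  refine ⟨key, ?_⟩
  rw [key, div_ne_zero_iff]
  exact and_iff_left hg1
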